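/- arXiv:2401.01161 — 2 statements merged into one kernel-verified Lean document; each statement's English description precedes it below -/
import Mathlib

section
/- (Carathéodory–Fejér) Any positive semidefinite Hermitian Toeplitz matrix T t ∈ ℂ^{n×n} of rank K < n admits a Vandermonde decomposition T t = A_n(f) diag(p) A_n(f)^H, where f₁,…,f_K ∈ 𝕋 are distinct, p_k > 0 for k = 1,…,K, and this decomposition is unique up to permutation of the indices k. -/
noncomputable section

open Complex Matrix Set
open scoped ComplexOrder

/-- The frequency domain `𝕋 = [-1/2, 1/2)`. -/
def freqDomain : Set ℝ := Set.Ico (-(1:ℝ)/2) (1/2)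

/-- The `n×n` Hermitian-Toeplitz matrix built from `t ∈ ℂ^{2n-1}`:
the `(j,k)` entry is `t_{n+k-j}` (1-based indexing as in the paper). -/
def toeplitzMat (n : ℕ) (t : Fin (2*n-1) → ℂ) : Matrix (Fin n) (Fin n) ℂ :=
  fun j k => t ⟨n + k.val - j.val - 1, by have hj := j.isLt; have hk := k.isLt; omega⟩

/-- The `n×K` Vandermonde matrix `A_n(f) = [a_n(f₁),…,a_n(f_K)]` with
`a_n(f) = (1, e^{i2πf}, …, e^{i2πf(n-1)})ᵀ`. -/
def vandMat (n K : ℕ) (f : Fin K → ℝ) : Matrix (Fin n) (Fin K) ℂ :=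
  fun j k => Complex.exp (Complex.I * (2 * Real.pi * f k * j))

open scoped InnerProductSpace

section Isometry

variable {E : Type*} [NormedAddCommGroup E] [InnerProductSpace ℂ E]

lemma LinearIsometry.norm_eq_one_of_map_eq_smul (U : E →ₗᵢ[ℂ] E) {μ : ℂ} {v : E} (hv : v ≠ 0)
    (h : U v = μ • v) : ‖μ‖ = 1 := by
  have h1 := U.norm_map v
  rw [h, norm_smul] at h1
  exact mul_right_cancel₀ (norm_ne_zero_iff.2 hv) (h1.trans (one_mul _).symm)

lemma LinearIsometry.inner_eq_zero_of_map_eq_smul (U : E →ₗᵢ[ℂ] E) {μ ν : ℂ} {v w : E}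
    (hμν : μ ≠ ν) (hv : U v = μ • v) (hw : U w = ν • w) : ⟪v, w⟫_ℂ = 0 := by
  rcases eq_or_ne v 0 with rfl | hv0
  · simp
  have hμ := U.norm_eq_one_of_map_eq_smul hv0 hv
  have hμ' : μ * starRingEnd ℂ μ = 1 := by rw [Complex.mul_conj', hμ]; simp
  have h1 := U.inner_map_map v w
  rw [hv, hw, inner_smul_left, inner_smul_right] at h1
  have h2 : (ν - μ) * ⟪v, w⟫_ℂ = 0 := by
    linear_combination μ * h1 - ν * ⟪v, w⟫_ℂ * hμ'
  exact (mul_eq_zero.1 h2).resolve_left (sub_ne_zero.2 hμν.symm)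

variable [FiniteDimensional ℂ E]

/-- Two finite families of vectors with the same Gram matrix are related by an isometry. -/
lemma exists_linearIsometry_of_inner_eq {ι : Type*} [Fintype ι] (b c : ι → E)
    (h : ∀ i j, ⟪b i, b j⟫_ℂ = ⟪c i, c j⟫_ℂ) :
    ∃ U : E →ₗᵢ[ℂ] E, ∀ i, U (b i) = c i := by
  classical
  let L := Fintype.linearCombination ℂ b
  let M := Fintype.linearCombination ℂ c
  have hLM : ∀ x, ‖M x‖ = ‖L x‖ := by
    intro x
    have : ⟪M x, M x⟫_ℂ = ⟪L x, L x⟫_ℂ := by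
      simp only [L, M, Fintype.linearCombination_apply, sum_inner, inner_sum, inner_smul_left,
        inner_smul_right, h]
    rw [inner_self_eq_norm_sq_to_K, inner_self_eq_norm_sq_to_K] at this
    have h2 : ‖M x‖ ^ 2 = ‖L x‖ ^ 2 := by exact_mod_cast this
    exact (sq_eq_sq₀ (norm_nonneg _) (norm_nonneg _)).1 h2
  obtain ⟨g, hg⟩ := L.rangeRestrict.exists_rightInverse_of_surjective L.range_rangeRestrict
  have hg' : ∀ y, L (g y) = y := fun y => congrArg Subtype.val (LinearMap.congr_fun hg y)
  let U₀ : LinearMap.range L →ₗᵢ[ℂ] E :=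
    ⟨M ∘ₗ g, fun y => by
      change ‖M (g y)‖ = ‖y‖
      rw [hLM, hg', Submodule.coe_norm]⟩
  refine ⟨U₀.extend, fun i => ?_⟩
  have hL : L (Pi.single i 1) = b i := by simp [L]
  have hM : M (Pi.single i 1) = c i := by simp [M]
  have hmem : b i ∈ LinearMap.range L := ⟨_, hL⟩
  have h1 := U₀.extend_apply ⟨b i, hmem⟩
  refine h1.trans ?_
  change M (g ⟨b i, hmem⟩) = c i
  rw [← hM, ← sub_eq_zero, ← map_sub, ← norm_eq_zero, hLM, map_sub, hg', hL, sub_self, norm_zero]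

lemma LinearIsometry.isSemisimple (U : E →ₗᵢ[ℂ] E) :
    Module.End.IsSemisimple (U.toLinearMap : Module.End ℂ E) := by
  rw [Module.End.isSemisimple_iff]
  intro p hp
  refine ⟨pᗮ, ?_, Submodule.isCompl_orthogonal p⟩
  rw [Module.End.mem_invtSubmodule] at hp ⊢
  intro y hy
  change U y ∈ pᗮ
  rw [Submodule.mem_orthogonal]
  intro x hx
  have hsurj : Function.Surjective (U.toLinearMap.restrict hp) := by
    rw [← LinearMap.injective_iff_surjective]
    intro u v huv
    exact Subtype.ext (U.injective (congrArg Subtype.val huv))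
  obtain ⟨x', hx'⟩ := hsurj ⟨x, hx⟩
  have : U x' = x := congrArg Subtype.val hx'
  rw [← this, U.inner_map_map]
  exact (Submodule.mem_orthogonal p y).1 hy _ x'.2

/-- Spectral decomposition of a vector with respect to an isometry. -/
lemma LinearIsometry.exists_eigenvector_decomposition (U : E →ₗᵢ[ℂ] E) (v : E) :
    ∃ L ≤ Module.finrank ℂ E, ∃ (μ : Fin L → ℂ) (g : Fin L → E), Function.Injective μ ∧
      (∀ i, ‖μ i‖ = 1) ∧ (∀ i, g i ≠ 0) ∧ (∀ i, U (g i) = μ i • g i) ∧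
      (∀ i j, i ≠ j → ⟪g i, g j⟫_ℂ = 0) ∧ ∑ i, g i = v := by
  have hv : v ∈ ⨆ μ : ℂ, Module.End.eigenspace (U.toLinearMap : Module.End ℂ E) μ := by
    rw [U.isSemisimple.iSup_eigenspace_eq_top]; trivial
  obtain ⟨G, hG, hsum⟩ := (Submodule.mem_iSup_iff_exists_finsupp _ _).1 hv
  have hG' : ∀ μ, U (G μ) = μ • G μ := fun μ => Module.End.mem_eigenspace_iff.1 (hG μ)
  let e := G.support.equivFin.symm
  have hne : ∀ i, G (e i) ≠ 0 := fun i => Finsupp.mem_support_iff.1 (e i).2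
  have hinj : Function.Injective fun i => (e i : ℂ) := Subtype.val_injective.comp e.injective
  have horth : ∀ i j, i ≠ j → ⟪G (e i), G (e j)⟫_ℂ = 0 := fun i j hij =>
    U.inner_eq_zero_of_map_eq_smul (hinj.ne hij) (hG' _) (hG' _)
  refine ⟨_, ?_, fun i => e i, fun i => G (e i), hinj,
    fun i => U.norm_eq_one_of_map_eq_smul (hne i) (hG' _), hne, fun i => hG' _, horth, ?_⟩
  · have := (linearIndependent_of_ne_zero_of_inner_eq_zero (𝕜 := ℂ) hne
      (fun i j hij => horth i j hij)).fintype_card_le_finrank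
    simpa using this
  · rw [e.sum_comp (fun x : G.support => G x), ← hsum, Finsupp.sum, Finset.sum_coe_sort]

end Isometry

/-- Frequencies in `freqDomain` are determined by their phase factor. -/
lemma freqDomain_injOn_exp :
    Set.InjOn (fun f : ℝ => cexp (I * (2 * Real.pi * f))) freqDomain := by
  intro f hf g hg h
  obtain ⟨hf1, hf2⟩ := hf
  obtain ⟨hg1, hg2⟩ := hg
  have hpi := Real.pi_pos
  have h' : cexp (-(I * (2 * Real.pi * f))) = cexp (-(I * (2 * Real.pi * g))) := by
    rw [Complex.exp_neg, Complex.exp_neg]; exact congrArg _ h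
  have im_eq : ∀ x : ℝ, (-(I * (2 * Real.pi * x))).im = -(2 * Real.pi * x) := by
    intro x; simp
  have := exp_inj_of_neg_pi_lt_of_le_pi (by rw [im_eq]; nlinarith) (by rw [im_eq]; nlinarith)
    (by rw [im_eq]; nlinarith) (by rw [im_eq]; nlinarith) h'
  have h3 := congrArg Complex.im this
  rw [im_eq, im_eq] at h3
  have : 2 * Real.pi * (f - g) = 0 := by linarith
  have := (mul_eq_zero.1 this).resolve_left (by positivity)
  linarith

lemma exists_mem_freqDomain_exp_eq {μ : ℂ} (hμ : ‖μ‖ = 1) :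
    ∃ f ∈ freqDomain, cexp (I * (2 * Real.pi * f)) = starRingEnd ℂ μ := by
  have hpi := Real.pi_pos
  refine ⟨-(arg μ) / (2 * Real.pi), ⟨?_, ?_⟩, ?_⟩
  · rw [le_div_iff₀ (by positivity)]; linarith [arg_le_pi μ]
  · rw [div_lt_iff₀ (by positivity)]; linarith [neg_pi_lt_arg μ]
  · have h1 : μ = cexp (arg μ * I) := by
      conv_lhs => rw [← norm_mul_exp_arg_mul_I μ, hμ]
      simp
    conv_rhs => rw [h1, ← Complex.exp_conj]
    congr 1
    have : (Real.pi : ℂ) ≠ 0 := by exact_mod_cast hpi.ne'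
    simp
    field_simp

lemma vandMat_apply (n K : ℕ) (f : Fin K → ℝ) (j : Fin n) (k : Fin K) :
    vandMat n K f j k = cexp (I * (2 * Real.pi * f k)) ^ (j : ℕ) := by
  rw [vandMat, ← Complex.exp_nat_mul]
  congr 1; ring

/-- A positively weighted Vandermonde Gram matrix with at most `n` distinct frequencies has rank
the number of frequencies. -/
lemma rank_vandMat_mul_diagonal_mul {n K : ℕ} (hK : K ≤ n) {f p : Fin K → ℝ}
    (hf : ∀ k, f k ∈ freqDomain) (hinj : Function.Injective f) (hp : ∀ k, 0 < p k) :
    (vandMat n K f * Matrix.diagonal (fun k => (p k : ℂ)) * (vandMat n K f)ᴴ).rank = K := by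
  set B := vandMat n K f * Matrix.diagonal (fun k => (Real.sqrt (p k) : ℂ)) with hB
  have h1 : vandMat n K f * Matrix.diagonal (fun k => (p k : ℂ)) * (vandMat n K f)ᴴ = B * Bᴴ := by
    rw [hB, conjTranspose_mul, diagonal_conjTranspose, Matrix.mul_assoc, Matrix.mul_assoc,
      ← Matrix.mul_assoc (diagonal _) (diagonal _), diagonal_mul_diagonal]
    congr 3
    funext k
    simp only [Pi.star_apply, RCLike.star_def, conj_ofReal]
    exact_mod_cast (Real.mul_self_sqrt (hp k).le).symm
  rw [h1, rank_self_mul_conjTranspose, hB, rank_mul_eq_left_of_det_ne_zero, ← rank_transpose]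
  · rw [LinearIndependent.rank_matrix, Fintype.card_fin]
    rw [Fintype.linearIndependent_iff]
    intro g hg
    have : g = 0 := by
      refine eq_zero_of_forall_pow_sum_mul_pow_eq_zero
        (f := fun k => cexp (I * (2 * Real.pi * f k))) ?_ ?_
      · exact fun a b hab => hinj (freqDomain_injOn_exp (hf a) (hf b) hab)
      · intro i
        have := congrFun hg ⟨i, i.2.trans_le hK⟩
        simpa [vandMat_apply] using this
    exact fun i => congrFun this i
  · rw [det_diagonal, Finset.prod_ne_zero_iff]
    intro k _
    exact_mod_cast (Real.sqrt_pos.2 (hp k)).ne'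

open scoped MatrixOrder Matrix.Norms.L2Operator in
lemma Matrix.PosSemidef.exists_eq_conjTranspose_mul_self {ι : Type*} [Fintype ι] [DecidableEq ι]
    {M : Matrix ι ι ℂ} (hM : M.PosSemidef) : ∃ B : Matrix ι ι ℂ, M = Bᴴ * B :=
  CStarAlgebra.nonneg_iff_eq_star_mul_self.mp hM.nonneg

/-- A positive semidefinite Toeplitz matrix has a Vandermonde decomposition with at most as many
frequencies as its size. -/
lemma exists_vandMat_decomposition {m : ℕ} {M : Matrix (Fin (m + 1)) (Fin (m + 1)) ℂ}
    (hM : M.PosSemidef) (htoep : ∀ j k : Fin m, M j.castSucc k.castSucc = M j.succ k.succ) :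
    ∃ L ≤ m + 1, ∃ f p : Fin L → ℝ, (∀ k, f k ∈ freqDomain) ∧ Function.Injective f ∧
      (∀ k, 0 < p k) ∧
      M = vandMat (m + 1) L f * Matrix.diagonal (fun k => (p k : ℂ)) * (vandMat (m + 1) L f)ᴴ := by
  obtain ⟨B, rfl⟩ := hM.exists_eq_conjTranspose_mul_self
  let b : Fin (m + 1) → EuclideanSpace ℂ (Fin (m + 1)) := fun j => WithLp.toLp 2 fun i => B i j
  have hb : ∀ j k, ⟪b j, b k⟫_ℂ = (Bᴴ * B) j k := by
    intro j k
    simp [b, PiLp.inner_apply, Matrix.mul_apply, mul_comm]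
  obtain ⟨U, hU⟩ := exists_linearIsometry_of_inner_eq (fun j : Fin m => b j.castSucc)
    (fun j : Fin m => b j.succ) (fun j k => by rw [hb, hb, htoep])
  obtain ⟨L, hL, μ, g, hμ, hμ1, hg0, hUg, horth, hsum⟩ := U.exists_eigenvector_decomposition (b 0)
  have hbj : ∀ j : Fin (m + 1), b j = ∑ i, μ i ^ (j : ℕ) • g i := by
    intro j
    induction j using Fin.induction with
    | zero => simp [hsum]
    | succ j ih =>
      rw [← hU j, ih, map_sum]
      refine Finset.sum_congr rfl fun i _ => ?_
      rw [map_smul, hUg, smul_smul, Fin.val_succ, pow_succ, Fin.val_castSucc]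
  choose f hf hfμ using fun i => exists_mem_freqDomain_exp_eq (hμ1 i)
  refine ⟨L, by simpa using hL, f, fun i => ‖g i‖ ^ 2, hf, ?_, ?_, ?_⟩
  · intro i j hij
    apply hμ
    apply (starRingEnd ℂ).injective
    rw [← hfμ, ← hfμ, hij]
  · intro i
    have := norm_pos_iff.2 (hg0 i)
    positivity
  · ext j k
    rw [← hb, hbj, hbj, sum_inner, Matrix.mul_apply]
    refine Finset.sum_congr rfl fun i _ => ?_
    rw [inner_sum, Finset.sum_eq_single i (fun l _ hl => by
      rw [inner_smul_left, inner_smul_right, horth i l hl.symm, mul_zero, mul_zero]) (by simp),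
      inner_smul_left, inner_smul_right, inner_self_eq_norm_sq_to_K, mul_diagonal,
      conjTranspose_apply, vandMat_apply, vandMat_apply, hfμ]
    simp
    ring

/-- The quadratic form of a Vandermonde decomposition, evaluated on polynomial coefficients. -/
lemma vandMat_quadraticForm {n K : ℕ} (f p : Fin K → ℝ) (q : Polynomial ℂ)
    (hq : q.natDegree < n) :
    star (fun j : Fin n => q.coeff j) ⬝ᵥ
      ((vandMat n K f * Matrix.diagonal (fun k => (p k : ℂ)) * (vandMat n K f)ᴴ) *ᵥ
        fun j : Fin n => q.coeff j) =
      ((∑ k, p k * ‖q.eval (starRingEnd ℂ (cexp (I * (2 * Real.pi * f k))))‖ ^ 2 : ℝ) : ℂ) := by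
  have hy : (vandMat n K f)ᴴ *ᵥ (fun j : Fin n => q.coeff j) =
      fun k => q.eval (starRingEnd ℂ (cexp (I * (2 * Real.pi * f k)))) := by
    funext k
    simp only [mulVec, dotProduct]
    rw [Polynomial.eval_eq_sum_range' hq, Finset.sum_range]
    refine Finset.sum_congr rfl fun j _ => ?_
    rw [conjTranspose_apply, vandMat_apply, mul_comm, star_pow, RCLike.star_def]
  have hstar : star (fun j : Fin n => q.coeff j) ᵥ* vandMat n K f =
      star ((vandMat n K f)ᴴ *ᵥ fun j : Fin n => q.coeff j) := by
    rw [star_mulVec, conjTranspose_conjTranspose]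
  rw [← mulVec_mulVec, ← mulVec_mulVec, hy, dotProduct_mulVec, hstar, hy]
  simp only [dotProduct, mulVec_diagonal]
  push_cast
  refine Finset.sum_congr rfl fun k _ => ?_
  rw [← Complex.mul_conj', Pi.star_apply, RCLike.star_def]
  ring

/-- Fewer than `n` frequencies and their weights are determined by the matrix. -/
lemma vandMat_decomposition_unique {n K : ℕ} (hK : K < n) {f p f' p' : Fin K → ℝ}
    (hf : ∀ k, f k ∈ freqDomain) (hinj : Function.Injective f)
    (hf' : ∀ k, f' k ∈ freqDomain) (hinj' : Function.Injective f') (hp' : ∀ k, 0 < p' k)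
    (h : vandMat n K f * Matrix.diagonal (fun k => (p k : ℂ)) * (vandMat n K f)ᴴ =
      vandMat n K f' * Matrix.diagonal (fun k => (p' k : ℂ)) * (vandMat n K f')ᴴ) :
    ∃ σ : Equiv.Perm (Fin K), (∀ k, f' k = f (σ k)) ∧ (∀ k, p' k = p (σ k)) := by
  let w : ℝ → ℂ := fun x => starRingEnd ℂ (cexp (I * (2 * Real.pi * x)))
  have hw : Set.InjOn w freqDomain := fun a ha b hb hab =>
    freqDomain_injOn_exp ha hb ((starRingEnd ℂ).injective hab)
  have hform : ∀ q : Polynomial ℂ, q.natDegree < n →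
      ∑ k, p k * ‖q.eval (w (f k))‖ ^ 2 = ∑ k, p' k * ‖q.eval (w (f' k))‖ ^ 2 := by
    intro q hq
    have h1 := vandMat_quadraticForm f p q hq
    rw [h, vandMat_quadraticForm f' p' q hq] at h1
    exact Complex.ofReal_injective h1.symm
  let P : Finset (Fin K) → Polynomial ℂ := fun s => ∏ i ∈ s, (Polynomial.X - Polynomial.C (w (f i)))
  have hdeg : ∀ s, (P s).natDegree < n := by
    intro s
    rw [Polynomial.natDegree_prod_of_monic _ _ fun i _ => Polynomial.monic_X_sub_C _]
    simpa using (s.card_le_univ.trans_eq (Fintype.card_fin K)).trans_lt hK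
  have heval : ∀ s x, (P s).eval x = 0 ↔ ∃ i ∈ s, x = w (f i) := by
    intro s x
    simp [P, Polynomial.eval_prod, Finset.prod_eq_zero_iff, sub_eq_zero]
  have hexists : ∀ k, ∃ i, f' k = f i := by
    intro k
    have h0 := hform (P Finset.univ) (hdeg _)
    rw [Finset.sum_eq_zero fun i _ => by
      rw [(heval _ _).2 ⟨i, Finset.mem_univ i, rfl⟩]; simp] at h0
    have h1 := (Finset.sum_eq_zero_iff_of_nonneg fun i _ =>
      mul_nonneg (hp' i).le (sq_nonneg _)).1 h0.symm k (Finset.mem_univ k)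
    have h2 : (P Finset.univ).eval (w (f' k)) = 0 := by
      simpa [(hp' k).ne'] using h1
    obtain ⟨i, -, hi⟩ := (heval _ _).1 h2
    exact ⟨i, hw (hf' k) (hf i) hi⟩
  choose s hs using hexists
  have hsinj : Function.Injective s := fun a b hab => hinj' (by rw [hs, hs, hab])
  refine ⟨Equiv.ofBijective s (Finite.injective_iff_bijective.1 hsinj), hs, fun k => ?_⟩
  change p' k = p (s k)
  have h0 := hform (P (Finset.univ.erase (s k))) (hdeg _)
  rw [Finset.sum_eq_single (s k) (fun i _ hi => by
      rw [(heval _ _).2 ⟨i, by simpa using hi, rfl⟩]; simp) (by simp),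
    Finset.sum_eq_single k (fun i _ hi => by
      rw [(heval _ _).2 ⟨s i, by simpa using hsinj.ne hi, by rw [hs]⟩]; simp) (by simp), hs] at h0
  refine (mul_right_cancel₀ (pow_ne_zero 2 (norm_ne_zero_iff.2 ?_)) h0).symm
  rw [Ne, heval]
  rintro ⟨i, hi, hik⟩
  exact (Finset.mem_erase.1 hi).1 (hinj (hw (hf _) (hf _) hik)).symm

/-- Carathéodory–Fejér: any PSD Hermitian Toeplitz matrix `T t ∈ ℂ^{n×n}` of
rank `K < n` admits a Vandermonde decomposition `T t = A_n(f) diag(p) A_n(f)ᴴ` with distinct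
`f₁,…,f_K ∈ 𝕋` and `p_k > 0`, and the decomposition is unique up to permutation. -/
theorem toeplitz_vandermonde_decomposition (n K : ℕ) (hK : K < n)
    (t : Fin (2*n-1) → ℂ) (hpsd : (toeplitzMat n t).PosSemidef)
    (hrank : (toeplitzMat n t).rank = K) :
    ∃ (f : Fin K → ℝ) (p : Fin K → ℝ),
      (∀ k, f k ∈ freqDomain) ∧ Function.Injective f ∧ (∀ k, 0 < p k) ∧
      toeplitzMat n t
        = vandMat n K f * Matrix.diagonal (fun k => (p k : ℂ)) * (vandMat n K f)ᴴ ∧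
      ∀ (f' p' : Fin K → ℝ), (∀ k, f' k ∈ freqDomain) → Function.Injective f' →
        (∀ k, 0 < p' k) →
        toeplitzMat n t
          = vandMat n K f' * Matrix.diagonal (fun k => (p' k : ℂ)) * (vandMat n K f')ᴴ →
        ∃ σ : Equiv.Perm (Fin K), (∀ k, f' k = f (σ k)) ∧ (∀ k, p' k = p (σ k)) := by
  obtain ⟨m, rfl⟩ : ∃ m, n = m + 1 := ⟨n - 1, by omega⟩
  obtain ⟨L, hL, f, p, hf, hinj, hp, heq⟩ := exists_vandMat_decomposition hpsd fun j k => by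
    unfold toeplitzMat
    congr 2
    simp only [Fin.val_castSucc, Fin.val_succ]
    omega
  obtain rfl : L = K := by rw [← hrank, heq, rank_vandMat_mul_diagonal_mul hL hf hinj hp]
  exact ⟨f, p, hf, hinj, hp, heq, fun f' p' hf' hinj' hp' heq' =>
    vandMat_decomposition_unique hK hf hinj hf' hinj' hp' (heq.symm.trans heq')⟩
end
end

section
/- If an n×n Hankel matrix H x can be factorized as H x = A_n(f) G A_n(f)^T, where f₁,…,f_K ∈ 𝕋 are distinct, K < n, and G ∈ ℂ^{K×K}, then G must be a diagonal matrix. -/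
noncomputable section

open Complex Matrix Set

/-- The `n×n` Hankel matrix built from `x ∈ ℂ^{2n-1}`:
the `(j,k)` entry is `x_{j+k-1}` (1-based indexing as in the paper). -/
def hankelMat (n : ℕ) (x : Fin (2*n-1) → ℂ) : Matrix (Fin n) (Fin n) ℂ :=
  fun j k => x ⟨j.val + k.val, by have hj := j.isLt; have hk := k.isLt; omega⟩

/-- The nodes `e^{i2πf}` are distinct for distinct frequencies `f ∈ 𝕋`. -/
lemma injOn_exp_freqDomain :
    Set.InjOn (fun t : ℝ => Complex.exp (Complex.I * (2 * Real.pi * t))) freqDomain := by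
  intro s hs t ht hst
  obtain ⟨m, hm⟩ := Complex.exp_eq_exp_iff_exists_int.mp hst
  have h2 : (2 * Real.pi * Complex.I : ℂ) ≠ 0 := Complex.two_pi_I_ne_zero
  have hc : (s : ℂ) = t + m := mul_left_cancel₀ h2 (by linear_combination hm)
  have hr : s = t + m := by exact_mod_cast hc
  obtain ⟨hs1, hs2⟩ := hs
  obtain ⟨ht1, ht2⟩ := ht
  have hm1 : (m : ℝ) < 1 := by linarith
  have hm2 : (-1 : ℝ) < m := by linarith
  have hm0 : m = 0 := by
    have : m < 1 := by exact_mod_cast hm1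
    have : -1 < m := by exact_mod_cast hm2
    omega
  simpa [hm0] using hr

lemma vandMat_apply_eq_pow (n K : ℕ) (f : Fin K → ℝ) (j : Fin n) (k : Fin K) :
    vandMat n K f j k = Complex.exp (Complex.I * (2 * Real.pi * f k)) ^ (j : ℕ) := by
  rw [vandMat, ← Complex.exp_nat_mul]
  ring_nf

/-- A bilinear form vanishing on all pairs of rows of an invertible Vandermonde matrix is zero. -/
lemma eq_zero_of_vandermonde_mul_mul {R : Type*} [Field R] {K : ℕ} {z : Fin K → R}
    (hz : Function.Injective z) {M : Matrix (Fin K) (Fin K) R}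
    (h : (vandermonde z)ᵀ * M * vandermonde z = 0) : M = 0 := by
  have hu : IsUnit (vandermonde z) := by
    rw [Matrix.isUnit_iff_isUnit_det]
    exact (det_vandermonde_ne_zero_iff.mpr hz).isUnit
  have hut : IsUnit (vandermonde z)ᵀ := (Matrix.isUnit_transpose _).mpr hu
  rwa [hu.mul_left_eq_zero, hut.mul_right_eq_zero] at h

/-- if an `n×n` Hankel matrix `H x` factorizes as `H x = A_n(f) G A_n(f)ᵀ`
with `f₁,…,f_K ∈ 𝕋` distinct and `K < n`, then `G` must be diagonal. -/
theorem hankel_factorization_diagonal (n K : ℕ) (hK : K < n) (x : Fin (2*n-1) → ℂ)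
    (f : Fin K → ℝ) (hf : ∀ k, f k ∈ freqDomain) (hinj : Function.Injective f)
    (G : Matrix (Fin K) (Fin K) ℂ)
    (hfac : hankelMat n x = vandMat n K f * G * (vandMat n K f)ᵀ) :
    G.IsDiag := by
  set z : Fin K → ℂ := fun k => Complex.exp (Complex.I * (2 * Real.pi * f k)) with hz
  have hzinj : Function.Injective z := fun a b hab =>
    hinj (injOn_exp_freqDomain (hf a) (hf b) hab)
  have entry (j l : Fin n) :
      hankelMat n x j l = ∑ b, (∑ a, z a ^ (j : ℕ) * G a b) * z b ^ (l : ℕ) := by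
    simp only [hfac, Matrix.mul_apply, Matrix.transpose_apply, vandMat_apply_eq_pow, hz]
  let M : Matrix (Fin K) (Fin K) ℂ := Matrix.of fun a b => (z a - z b) * G a b
  have hM : M = 0 := by
    refine eq_zero_of_vandermonde_mul_mul hzinj ?_
    ext j l
    have hshift : hankelMat n x ⟨j + 1, by omega⟩ ⟨l, by omega⟩ =
        hankelMat n x ⟨j, by omega⟩ ⟨l + 1, by omega⟩ := by
      simp only [hankelMat]
      congr 2
      omega
    rw [entry, entry, ← sub_eq_zero, ← Finset.sum_sub_distrib] at hshift
    rw [Matrix.zero_apply, ← hshift, Matrix.mul_apply]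
    refine Finset.sum_congr rfl fun b _ => ?_
    simp only [Matrix.mul_apply, Matrix.transpose_apply, vandermonde_apply, M, Matrix.of_apply,
      Finset.sum_mul, ← Finset.sum_sub_distrib]
    refine Finset.sum_congr rfl fun a _ => ?_
    ring
  intro a b hab
  have h := congrFun (congrFun hM a) b
  exact (mul_eq_zero.mp h).resolve_left (sub_ne_zero.mpr (hzinj.ne hab))
end
end
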